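/- arXiv:1211.4346 — 2 statements merged into one kernel-verified Lean document; each statement's English description precedes it below -/
import Mathlib

section
/- Let A ∈ 𝓑. The homogeneous Bellman equation f = I_A f has no bounded measurable solution other than f ≡ 0 if and only if u(x;A) = 0 for all x ∈ X. -/
open MeasureTheory ProbabilityTheory

variable {X : Type*} [MeasurableSpace X]

/-- Transition operator: `(Pf)(x) = ∫ f(y) P(x,dy)`. -/
noncomputable def transOp (P : Kernel X X) (f : X → ℝ) : X → ℝ :=
  fun x => ∫ y, f y ∂(P x)

/-- Invariance operator `I_A f = 1_A · (Pf)`. -/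
noncomputable def invOp (P : Kernel X X) (A : Set X) (f : X → ℝ) : X → ℝ :=
  A.indicator (transOp P f)

/-- Invariance value functions `u_n(·;A)`. -/
noncomputable def uN (P : Kernel X X) (A : Set X) : ℕ → X → ℝ
  | 0 => A.indicator 1
  | n + 1 => invOp P A (uN P A n)

/-- `u(x;A) = lim_n u_n(x;A)` (the sequence is pointwise nonincreasing). -/
noncomputable def uFun (P : Kernel X X) (A : Set X) : X → ℝ :=
  fun x => ⨅ n, uN P A n x

/-- Reach-avoid value functions `w_n(·;A,B)`. -/
noncomputable def wN (P : Kernel X X) (A B : Set X) : ℕ → X → ℝ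
  | 0 => B.indicator 1
  | n + 1 => fun x => B.indicator 1 x + invOp P (A \ B) (wN P A B n) x

/-- `w(x;A,B) = lim_n w_n(x;A,B)` (the sequence is pointwise nondecreasing, in `[0,1]`). -/
noncomputable def wFun (P : Kernel X X) (A B : Set X) : X → ℝ :=
  fun x => ⨆ n, wN P A B n x

/-- A bounded function. -/
def BddFun (f : X → ℝ) : Prop := ∃ C : ℝ, ∀ x, |f x| ≤ C

/-- A set `S` is absorbing if `P(x,S) = 1` for all `x ∈ S`. -/
def Absorbing (P : Kernel X X) (S : Set X) : Prop := ∀ x ∈ S, P x S = 1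

/-- A set is simple if its only absorbing measurable subset is empty. -/
def Simple (P : Kernel X X) (A : Set X) : Prop :=
  ∀ S ⊆ A, MeasurableSet S → Absorbing P S → S = ∅


section

variable {P : Kernel X X} {A : Set X}

theorem Measurable.transOp [IsMarkovKernel P] {f : X → ℝ} (hf : Measurable f) :
    Measurable (transOp P f) :=
  (hf.stronglyMeasurable.integral_kernel (κ := P)).measurable

theorem BddFun.integrable [IsMarkovKernel P] {f : X → ℝ} (hb : BddFun f) (hf : Measurable f)
    (x : X) : Integrable f (P x) := by
  obtain ⟨C, hC⟩ := hb
  exact .of_bound hf.aestronglyMeasurable C (.of_forall hC)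

theorem invOp_mono [IsMarkovKernel P] {f g : X → ℝ} (hf : Measurable f) (hfb : BddFun f)
    (hg : Measurable g) (hgb : BddFun g) (h : ∀ x, f x ≤ g x) (x : X) :
    invOp P A f x ≤ invOp P A g x :=
  Set.indicator_le_indicator (integral_mono (hfb.integrable hf x) (hgb.integrable hg x) h)

theorem measurable_uN [IsMarkovKernel P] (hA : MeasurableSet A) (n : ℕ) :
    Measurable (uN P A n) := by
  induction n with
  | zero => exact measurable_one.indicator hA
  | succ n ih => exact ih.transOp.indicator hA

theorem uN_nonneg (n : ℕ) (x : X) : 0 ≤ uN P A n x := by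
  induction n generalizing x with
  | zero => exact Set.indicator_nonneg (fun _ _ => zero_le_one) x
  | succ n ih => exact Set.indicator_nonneg (fun _ _ => integral_nonneg ih) x

theorem uN_zero_le_one (x : X) : uN P A 0 x ≤ 1 :=
  Set.indicator_le_self' (fun _ _ => zero_le_one) x

theorem uN_le_one [IsMarkovKernel P] (hA : MeasurableSet A) (n : ℕ) (x : X) :
    uN P A n x ≤ 1 := by
  induction n generalizing x with
  | zero => exact uN_zero_le_one x
  | succ n ih =>
    refine Set.indicator_apply_le' (fun _ => ?_) (fun _ => zero_le_one)
    have hb : BddFun (uN P A n) := ⟨1, fun y => by rw [abs_of_nonneg (uN_nonneg n y)]; exact ih y⟩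
    calc transOp P (uN P A n) x ≤ ∫ _, (1 : ℝ) ∂(P x) :=
          integral_mono (hb.integrable (measurable_uN hA n) x) (integrable_const 1) ih
      _ = 1 := by simp

theorem abs_uN_le_one [IsMarkovKernel P] (hA : MeasurableSet A) (n : ℕ) (x : X) :
    |uN P A n x| ≤ 1 := by
  rw [abs_of_nonneg (uN_nonneg n x)]
  exact uN_le_one hA n x

theorem bddFun_uN [IsMarkovKernel P] (hA : MeasurableSet A) (n : ℕ) : BddFun (uN P A n) :=
  ⟨1, abs_uN_le_one hA n⟩

theorem uN_succ_le [IsMarkovKernel P] (hA : MeasurableSet A) (n : ℕ) (x : X) :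
    uN P A (n + 1) x ≤ uN P A n x := by
  induction n generalizing x with
  | zero =>
    by_cases hx : x ∈ A
    · simpa [uN, hx] using uN_le_one (P := P) hA 1 x
    · simp [uN, invOp, hx]
  | succ n ih =>
    exact invOp_mono (measurable_uN hA _) (bddFun_uN hA _) (measurable_uN hA _) (bddFun_uN hA _)
      ih x

theorem bddBelow_range_uN (x : X) : BddBelow (Set.range fun n => uN P A n x) :=
  ⟨0, Set.forall_mem_range.2 fun n => uN_nonneg n x⟩

theorem tendsto_uN [IsMarkovKernel P] (hA : MeasurableSet A) (x : X) :
    Filter.Tendsto (fun n => uN P A n x) Filter.atTop (nhds (uFun P A x)) :=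
  tendsto_atTop_ciInf (antitone_nat_of_succ_le fun n => uN_succ_le hA n x) (bddBelow_range_uN x)

theorem measurable_uFun [IsMarkovKernel P] (hA : MeasurableSet A) : Measurable (uFun P A) :=
  .iInf fun n => measurable_uN hA n

theorem bddFun_uFun [IsMarkovKernel P] (hA : MeasurableSet A) : BddFun (uFun P A) :=
  ⟨1, fun x => le_of_tendsto' (tendsto_uN hA x).abs fun n => abs_uN_le_one hA n x⟩

theorem uFun_eq_invOp [IsMarkovKernel P] (hA : MeasurableSet A) (x : X) :
    uFun P A x = invOp P A (uFun P A) x := by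
  refine tendsto_nhds_unique ((tendsto_uN hA x).comp (Filter.tendsto_add_atTop_nat 1)) ?_
  by_cases hx : x ∈ A
  · simpa [Function.comp_def, uN, invOp, transOp, hx] using
      tendsto_integral_of_dominated_convergence (μ := P x) (F := uN P A) (fun _ => (1 : ℝ))
        (fun n => (measurable_uN hA n).aestronglyMeasurable) (integrable_const 1)
        (fun n => .of_forall (abs_uN_le_one hA n)) (.of_forall (tendsto_uN hA))
  · simp [Function.comp_def, uN, invOp, hx]

/-- A solution of the Bellman equation bounded by `C` is dominated by every `C · u_n`. -/
theorem abs_le_mul_uN [IsMarkovKernel P] {f : X → ℝ} {C : ℝ}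
    (hC : ∀ x, |f x| ≤ C) (heq : ∀ x, f x = invOp P A f x) (hA : MeasurableSet A) (n : ℕ) (x : X) :
    |f x| ≤ C * uN P A n x := by
  induction n generalizing x with
  | zero =>
    by_cases hx : x ∈ A
    · simpa [uN, hx] using hC x
    · simp [uN, heq x, invOp, hx]
  | succ n ih =>
    by_cases hx : x ∈ A
    · rw [heq x]
      simp only [uN, invOp, hx, Set.indicator_of_mem, transOp]
      rw [← integral_const_mul]
      exact norm_integral_le_of_norm_le (f := f) (g := fun y => C * uN P A n y)
        (((bddFun_uN hA n).integrable (measurable_uN hA n) x).const_mul C) (.of_forall ih)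
    · simp [uN, heq x, invOp, hx]

end

/-- the homogeneous Bellman equation `f = I_A f` has no bounded measurable
solution other than `f ≡ 0` if and only if `u(·;A) ≡ 0`. -/
theorem stmt7 (P : Kernel X X) [IsMarkovKernel P] (A : Set X) (hA : MeasurableSet A) :
    (∀ f : X → ℝ, Measurable f → BddFun f → (∀ x, f x = invOp P A f x) → ∀ x, f x = 0) ↔
      (∀ x : X, uFun P A x = 0) := by
  refine ⟨fun h => h _ (measurable_uFun hA) (bddFun_uFun hA) (uFun_eq_invOp hA), ?_⟩
  rintro hu f - ⟨C, hC⟩ heq x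
  have hle : |f x| ≤ C * uFun P A x :=
    ge_of_tendsto' ((tendsto_uN hA x).const_mul C) fun n => abs_le_mul_uN hC heq hA n x
  rw [hu x, mul_zero] at hle
  exact abs_nonpos_iff.1 hle
end

section
/- Let X = ℕ with the discrete σ-algebra and let the Markov kernel be given by a stochastic matrix (p_{ij}), i.e. P(i,{j}) = p_{ij}. Let A, B ⊆ ℕ be disjoint with A finite, set Ã := A \ l.a.s.(A) and b_i := Σ_{j∈B} p_{ij}. Then there is exactly one bounded function v : ℕ → ℝ satisfying v(i) = 1 for i ∈ B, v(i) = b_i + Σ_{j∈Ã} p_{ij} v(j) for i ∈ Ã, and v(i) = 0 for all other i, and this unique solution is v = w(·;A,B). -/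
open MeasureTheory ProbabilityTheory

variable {X : Type*} [MeasurableSpace X]

/-- The linear system characterizing the reach-avoid value function of a discrete-time
Markov chain on `ℕ`: `v(i) = 1` for `i ∈ B`, `v(i) = b_i + Σ_{j ∈ Ã} p_{ij} v(j)` for
`i ∈ Ã := A \ l.a.s.(A)` (with `b_i = Σ_{j∈B} p_{ij}`), and `v(i) = 0` otherwise. -/
def ReachAvoidSystem (P : Kernel ℕ ℕ) (A B : Set ℕ) (v : ℕ → ℝ) : Prop :=
  BddFun v ∧
    (∀ i ∈ B, v i = 1) ∧
    (∀ i ∈ A \ {x | uFun P A x = 1},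
      v i = (∑' j : B, (P i {(j : ℕ)}).toReal) +
        ∑' j : (A \ {x | uFun P A x = 1} : Set ℕ), (P i {(j : ℕ)}).toReal * v j) ∧
    (∀ i : ℕ, i ∉ B → i ∉ A \ {x | uFun P A x = 1} → v i = 0)

theorem bddFun_of_mem_Icc {X : Type*} {f : X → ℝ} (hf : ∀ x, f x ∈ Set.Icc (0 : ℝ) 1) : BddFun f :=
  ⟨1, fun x => abs_le.2 ⟨by linarith [(hf x).1], (hf x).2⟩⟩

theorem wN_of_mem {P : Kernel X X} {A B : Set X} {x : X} (hx : x ∈ B) (n : ℕ) :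
    wN P A B n x = 1 := by
  cases n <;> simp [wN, invOp, hx]

theorem wN_of_notMem {P : Kernel X X} {A B : Set X} {x : X} (hA : x ∉ A) (hB : x ∉ B) (n : ℕ) :
    wN P A B n x = 0 := by
  cases n <;> simp [wN, invOp, hA, hB]

theorem wN_succ_of_mem {P : Kernel X X} {A B : Set X} {x : X} (hA : x ∈ A) (hB : x ∉ B) (n : ℕ) :
    wN P A B (n + 1) x = transOp P (wN P A B n) x := by
  simp [wN, invOp, hA, hB]

section Discrete

variable [DiscreteMeasurableSpace X] [Countable X] {P : Kernel X X} {A B : Set X}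

theorem BddFun.integrable_s18 {f : X → ℝ} (hf : BddFun f) (μ : Measure X) [IsFiniteMeasure μ] :
    Integrable f μ := by
  obtain ⟨C, hC⟩ := hf
  exact Integrable.of_bound (measurable_of_countable f).aestronglyMeasurable C
    (Filter.Eventually.of_forall hC)

theorem transOp_mem_Icc [IsMarkovKernel P] {f : X → ℝ}
    (hf : ∀ x, f x ∈ Set.Icc (0 : ℝ) 1) (x : X) : transOp P f x ∈ Set.Icc (0 : ℝ) 1 := by
  refine ⟨integral_nonneg fun y => (hf y).1, ?_⟩
  have h := integral_mono ((bddFun_of_mem_Icc hf).integrable_s18 (P x)) (integrable_const 1)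
    fun y => (hf y).2
  simpa [transOp] using h

/-- If the mean of a bounded function attains an upper bound `c` of the function, then the function
is almost surely equal to `c`. -/
theorem ae_eq_of_le_integral {μ : Measure X} [IsProbabilityMeasure μ] {f : X → ℝ} {c : ℝ}
    (hf : BddFun f) (hle : ∀ x, f x ≤ c) (hc : c ≤ ∫ y, f y ∂μ) : ∀ᵐ y ∂μ, f y = c := by
  have hi := hf.integrable_s18 μ
  have h0 : ∫ y, (c - f y) ∂μ = 0 := by
    refine le_antisymm ?_ (integral_nonneg fun y => sub_nonneg.2 (hle y))
    rw [integral_sub (integrable_const c) hi]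
    simpa using hc
  have h1 := (integral_eq_zero_iff_of_nonneg (fun y => sub_nonneg.2 (hle y))
    ((integrable_const c).sub hi)).1 h0
  filter_upwards [h1] with y hy
  exact (sub_eq_zero.1 hy).symm

theorem uN_mem_Icc [IsMarkovKernel P] (n : ℕ) (x : X) : uN P A n x ∈ Set.Icc (0 : ℝ) 1 := by
  induction n generalizing x with
  | zero => by_cases hx : x ∈ A <;> simp [uN, hx]
  | succ n ih =>
    by_cases hx : x ∈ A
    · simpa [uN, invOp, hx] using transOp_mem_Icc ih x
    · simp [uN, invOp, hx]

theorem uFun_eq_one_iff [IsMarkovKernel P] {x : X} :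
    uFun P A x = 1 ↔ ∀ n, uN P A n x = 1 := by
  refine ⟨fun h n => le_antisymm (uN_mem_Icc n x).2 ?_, fun h => by simp [uFun, h]⟩
  rw [← h]
  exact ciInf_le ⟨0, by rintro _ ⟨k, rfl⟩; exact (uN_mem_Icc k x).1⟩ n

theorem mem_of_uFun_eq_one [IsMarkovKernel P] {x : X} (h : uFun P A x = 1) : x ∈ A := by
  by_contra hx
  simpa [uN, hx] using uFun_eq_one_iff.1 h 0

theorem ae_uFun_eq_one [IsMarkovKernel P] {x : X} (h : uFun P A x = 1) :
    ∀ᵐ y ∂(P x), uFun P A y = 1 := by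
  have hx := mem_of_uFun_eq_one h
  simp only [uFun_eq_one_iff, ae_all_iff]
  intro n
  refine ae_eq_of_le_integral (bddFun_of_mem_Icc (uN_mem_Icc n)) (fun y => (uN_mem_Icc n y).2) ?_
  have h1 := uFun_eq_one_iff.1 h (n + 1)
  simp only [uN, invOp, Set.indicator_of_mem hx] at h1
  exact h1.ge

theorem uFun_eq_one_of_ae_mem [IsMarkovKernel P] {S : Set X} (hSA : S ⊆ A)
    (hS : ∀ x ∈ S, ∀ᵐ y ∂(P x), y ∈ S) {x : X} (hx : x ∈ S) : uFun P A x = 1 := by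
  refine uFun_eq_one_iff.2 fun n => ?_
  induction n generalizing x with
  | zero => simp [uN, hSA hx]
  | succ n ih =>
    have h : transOp P (uN P A n) x = ∫ _, (1 : ℝ) ∂(P x) :=
      integral_congr_ae ((hS x hx).mono fun y hy => ih hy)
    simpa [uN, invOp, hSA hx] using h

theorem wN_mem_Icc [IsMarkovKernel P] (n : ℕ) (x : X) :
    wN P A B n x ∈ Set.Icc (0 : ℝ) 1 := by
  induction n generalizing x with
  | zero => by_cases hx : x ∈ B <;> simp [wN, hx]
  | succ n ih =>
    by_cases hB : x ∈ B
    · simp [wN_of_mem hB]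
    · by_cases hA : x ∈ A
      · simpa [wN_succ_of_mem hA hB] using transOp_mem_Icc ih x
      · simp [wN_of_notMem hA hB]

theorem wN_monotone [IsMarkovKernel P] (x : X) : Monotone fun n => wN P A B n x := by
  refine monotone_nat_of_le_succ fun n => ?_
  induction n generalizing x with
  | zero =>
    by_cases hB : x ∈ B
    · simp [wN_of_mem hB]
    · simpa [wN, hB] using (wN_mem_Icc (P := P) (A := A) (B := B) 1 x).1
  | succ n ih =>
    by_cases hB : x ∈ B
    · simp [wN_of_mem hB]
    · by_cases hA : x ∈ A
      · rw [wN_succ_of_mem hA hB, wN_succ_of_mem hA hB]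
        exact integral_mono ((bddFun_of_mem_Icc (wN_mem_Icc n)).integrable_s18 _)
          ((bddFun_of_mem_Icc (wN_mem_Icc (n + 1))).integrable_s18 _) ih
      · simp [wN_of_notMem hA hB]

theorem tendsto_wN [IsMarkovKernel P] (x : X) :
    Filter.Tendsto (fun n => wN P A B n x) Filter.atTop (nhds (wFun P A B x)) :=
  tendsto_atTop_ciSup (wN_monotone x) ⟨1, by rintro _ ⟨k, rfl⟩; exact (wN_mem_Icc k x).2⟩

theorem wFun_mem_Icc [IsMarkovKernel P] (x : X) : wFun P A B x ∈ Set.Icc (0 : ℝ) 1 :=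
  isClosed_Icc.mem_of_tendsto (tendsto_wN x) (Filter.Eventually.of_forall fun n => wN_mem_Icc n x)

theorem wFun_eq_transOp [IsMarkovKernel P] {x : X} (hA : x ∈ A) (hB : x ∉ B) :
    wFun P A B x = transOp P (wFun P A B) x := by
  have h1 := (Filter.tendsto_add_atTop_iff_nat 1).2 (tendsto_wN (P := P) (A := A) (B := B) x)
  simp only [wN_succ_of_mem hA hB] at h1
  refine tendsto_nhds_unique h1 (tendsto_integral_of_dominated_convergence (fun _ => 1)
    (fun n => (measurable_of_countable _).aestronglyMeasurable) (integrable_const 1)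
    (fun n => Filter.Eventually.of_forall fun y => ?_)
    (Filter.Eventually.of_forall fun y => tendsto_wN y))
  rw [Real.norm_eq_abs, abs_of_nonneg (wN_mem_Icc n y).1]
  exact (wN_mem_Icc n y).2

theorem wN_of_uFun_eq_one [IsMarkovKernel P] (hAB : Disjoint A B) {x : X}
    (h : uFun P A x = 1) (n : ℕ) : wN P A B n x = 0 := by
  have hA := mem_of_uFun_eq_one h
  have hB := hAB.notMem_of_mem_left hA
  induction n generalizing x with
  | zero => simp [wN, hB]
  | succ n ih =>
    rw [wN_succ_of_mem hA hB]
    refine integral_eq_zero_of_ae ((ae_uFun_eq_one h).mono fun y hy => ?_)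
    have hyA := mem_of_uFun_eq_one hy
    exact ih hy hyA (hAB.notMem_of_mem_left hyA)

/-- Maximum principle: a function that is harmonic on `A \ l.a.s.(A)` with `A` finite, and that
vanishes off this set, is zero. -/
theorem eq_zero_of_harmonic [IsMarkovKernel P] (hA : A.Finite) {d : X → ℝ}
    (hd : ∀ x ∈ A \ {x | uFun P A x = 1}, d x = transOp P d x)
    (h0 : ∀ x ∉ A \ {x | uFun P A x = 1}, d x = 0) : d = 0 := by
  by_contra hne
  obtain ⟨z, hz⟩ := Function.ne_iff.1 hne
  have hmem : ∀ {x}, d x ≠ 0 → x ∈ A \ {x | uFun P A x = 1} := fun {x} hx => by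
    by_contra h
    exact hx (h0 x h)
  obtain ⟨m, hmA, hm⟩ := hA.exists_maximalFor (fun x => |d x|) A ⟨z, (hmem hz).1⟩
  have hmax : ∀ x, |d x| ≤ |d m| := fun x => by
    by_cases hx : x ∈ A
    · exact (le_total |d x| |d m|).elim id fun h => hm hx h
    · rw [h0 x fun h => hx h.1]
      simp
  have hpos : 0 < |d m| := (abs_pos.2 hz).trans_le (hmax z)
  have hS : ∀ {x}, |d x| = |d m| → x ∈ A \ {x | uFun P A x = 1} := fun {x} hx =>
    hmem (abs_pos.1 (hx ▸ hpos))
  refine (hS (x := m) rfl).2 (uFun_eq_one_of_ae_mem (S := {x | |d x| = |d m|})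
    (fun x hx => (hS hx).1) (fun x hx => ?_) rfl)
  refine ae_eq_of_le_integral ⟨|d m|, fun y => by simpa using hmax y⟩ hmax ?_
  calc |d m| = |transOp P d x| := by rw [← hd x (hS hx)]; exact hx.symm
    _ ≤ ∫ y, |d y| ∂(P x) := abs_integral_le_integral_abs

theorem integral_eq_tsum_add_tsum {μ : Measure X} [IsFiniteMeasure μ] {T : Set X} {v : X → ℝ}
    (hv : BddFun v) (hBT : Disjoint T B) (hB : ∀ x ∈ B, v x = 1)
    (h0 : ∀ x, x ∉ B → x ∉ T → v x = 0) :
    ∫ y, v y ∂μ = (∑' j : B, (μ {(j : X)}).toReal) + ∑' j : T, (μ {(j : X)}).toReal * v j := by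
  have hsplit : v = fun y => B.indicator v y + T.indicator v y := by
    funext y
    by_cases hyB : y ∈ B
    · simp [hyB, hBT.notMem_of_mem_right hyB]
    · by_cases hyT : y ∈ T <;> simp [hyB, hyT, h0 y hyB]
  have hint (S : Set X) : ∫ y, S.indicator v y ∂μ = ∑' j : S, (μ {(j : X)}).toReal * v j := by
    rw [integral_countable ((hv.integrable_s18 μ).indicator (MeasurableSet.of_discrete (s := S))),
      tsum_subtype S fun j => (μ {j}).toReal * v j]
    refine tsum_congr fun j => ?_
    by_cases hj : j ∈ S <;> simp [hj, Measure.real]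
  conv_lhs => rw [hsplit]
  rw [integral_add ((hv.integrable_s18 μ).indicator MeasurableSet.of_discrete)
    ((hv.integrable_s18 μ).indicator MeasurableSet.of_discrete), hint, hint]
  congr 1
  exact tsum_congr fun j => by rw [hB j j.2, mul_one]

end Discrete

theorem reachAvoidSystem_iff {P : Kernel ℕ ℕ} [IsMarkovKernel P] {A B : Set ℕ}
    (hAB : Disjoint A B) {v : ℕ → ℝ} :
    ReachAvoidSystem P A B v ↔ BddFun v ∧ (∀ i ∈ B, v i = 1) ∧
      (∀ i ∈ A \ {x | uFun P A x = 1}, v i = transOp P v i) ∧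
      (∀ i : ℕ, i ∉ B → i ∉ A \ {x | uFun P A x = 1} → v i = 0) := by
  refine and_congr_right fun hv => and_congr_right fun hB => and_congr_left fun h0 => ?_
  refine forall₂_congr fun i _ => ?_
  rw [transOp, integral_eq_tsum_add_tsum hv (hAB.mono_left Set.sdiff_subset) hB h0]

theorem reachAvoidSystem_wFun {P : Kernel ℕ ℕ} [IsMarkovKernel P] {A B : Set ℕ}
    (hAB : Disjoint A B) : ReachAvoidSystem P A B (wFun P A B) := by
  refine (reachAvoidSystem_iff hAB).2 ⟨bddFun_of_mem_Icc wFun_mem_Icc,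
    fun i hi => by simp [wFun, wN_of_mem hi],
    fun i hi => wFun_eq_transOp hi.1 (hAB.notMem_of_mem_left hi.1), fun i hB hi => ?_⟩
  by_cases hA : i ∈ A
  · have hu : uFun P A i = 1 := by
      by_contra h
      exact hi ⟨hA, h⟩
    simp [wFun, wN_of_uFun_eq_one hAB hu]
  · simp [wFun, wN_of_notMem hA hB]

theorem ReachAvoidSystem.unique {P : Kernel ℕ ℕ} [IsMarkovKernel P] {A B : Set ℕ}
    (hAB : Disjoint A B) (hA : A.Finite) {v w : ℕ → ℝ} (hv : ReachAvoidSystem P A B v)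
    (hw : ReachAvoidSystem P A B w) : v = w := by
  obtain ⟨hvb, hvB, hvT, hv0⟩ := (reachAvoidSystem_iff hAB).1 hv
  obtain ⟨hwb, hwB, hwT, hw0⟩ := (reachAvoidSystem_iff hAB).1 hw
  refine sub_eq_zero.1 (eq_zero_of_harmonic (P := P) hA (fun x hx => ?_) fun x hx => ?_)
  · rw [Pi.sub_apply, hvT x hx, hwT x hx]
    exact (integral_sub (hvb.integrable_s18 _) (hwb.integrable_s18 _)).symm
  · by_cases hB : x ∈ B
    · simp [hvB x hB, hwB x hB]
    · simp [hv0 x hB hx, hw0 x hB hx]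

/-- for a Markov chain on `ℕ` and disjoint `A, B` with `A` finite, there is
exactly one bounded function solving the above linear system, and this unique solution is the
reach-avoid value function `w(·;A,B)`. -/
theorem stmt18 (P : Kernel ℕ ℕ) [IsMarkovKernel P] (A B : Set ℕ)
    (hAB : Disjoint A B) (hAfin : A.Finite) :
    (∃! v : ℕ → ℝ, ReachAvoidSystem P A B v) ∧
      ReachAvoidSystem P A B (wFun P A B) :=
  have hw := reachAvoidSystem_wFun hAB
  ⟨⟨_, hw, fun _ hv => hv.unique hAB hAfin hw⟩, hw⟩
end
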